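/- Fix an increasing sequence (k_n)_{n≥1} of positive integers with k_n ≤ n for all n and k_n → ∞. Let ST_n be the number of equivalence classes of simple tautologies of size n using at most k_n distinct variables, let T_n be the number of equivalence classes of all and/or trees of size n using at most k_n distinct variables, and set rat_n = B_{n−1,k_n}/B_{n,k_n}. Then, asymptotically as n → ∞, ST_n/T_n ∼ (3/4)·rat_n. -/

import Mathlib

open Filter

namespace CatalanSat

/-- A logical connective: `and` or `or`. -/
inductive Conn : Type
  | and : Conn
  | or : Conn

/-- An and/or tree: a binary plane tree with internal nodes labelled by a
connective and leaves labelled by a literal `(v, b)`: variable `v`, positive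
if `b = true`, negated if `b = false`. -/
inductive AOTree : Type
  | leaf (v : ℕ) (b : Bool) : AOTree
  | node (c : Conn) (l r : AOTree) : AOTree

namespace AOTree

/-- The list of leaf labels (variable index, polarity), from left to right. -/
def leaves : AOTree → List (ℕ × Bool)
  | .leaf v b => [(v, b)]
  | .node _ l r => leaves l ++ leaves r

/-- The size of an and/or tree is its number of leaves. -/
def size (t : AOTree) : ℕ := t.leaves.length

/-- The number of distinct variables appearing as leaf labels. -/
def varCount (t : AOTree) : ℕ := (t.leaves.map Prod.fst).toFinset.card

/-- The Boolean function computed by an and/or tree. -/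
def eval : AOTree → (ℕ → Bool) → Bool
  | .leaf v b, x => if b then x v else !(x v)
  | .node .and l r, x => eval l x && eval r x
  | .node .or l r, x => eval l x || eval r x

end AOTree

/-- A tree-structure: a binary plane tree with internal nodes labelled by a
connective and unlabelled leaves. -/
inductive Shape : Type
  | leaf : Shape
  | node (c : Conn) (l r : Shape) : Shape

/-- The size of a tree-structure is its number of leaves. -/
def Shape.size : Shape → ℕ
  | .leaf => 1
  | .node _ l r => Shape.size l + Shape.size r

/-- The tree-structure of an and/or tree (forget the leaf labels). -/
def AOTree.shape : AOTree → Shape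
  | .leaf _ _ => .leaf
  | .node c l r => .node c l.shape r.shape

/-- The label of the `i`-th leaf (junk default when out of range). -/
def lv (t : AOTree) (i : ℕ) : ℕ × Bool := t.leaves.getD i (0, true)

/-- Two and/or trees are equivalent when they have the same tree-structure,
two leaves are labelled by the same variable in one iff they are in the other,
and two leaves are labelled by the same literal in one iff they are in the other. -/
def TreeEquiv (A B : AOTree) : Prop :=
  A.shape = B.shape ∧
  ∀ i j : ℕ, i < A.leaves.length → j < A.leaves.length →
    (((lv A i).1 = (lv A j).1) ↔ ((lv B i).1 = (lv B j).1)) ∧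
    ((lv A i = lv A j) ↔ (lv B i = lv B j))

/-- The equivalence relation on Boolean functions induced by equivalence of trees. -/
def FunEquiv (f g : (ℕ → Bool) → Bool) : Prop :=
  ∃ A B : AOTree, TreeEquiv A B ∧ A.eval = f ∧ B.eval = g

/-- The number of equivalence classes of and/or trees satisfying a property
(the property being assumed invariant under equivalence). -/
noncomputable def classCount (P : AOTree → Prop) : ℕ :=
  Nat.card (Quot (fun A B : {t : AOTree // P t} => TreeEquiv A.1 B.1))

/-- `Tcount n K`: number of equivalence classes of and/or trees of size `n`
using at most `K` distinct variables. -/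
noncomputable def Tcount (n K : ℕ) : ℕ := classCount fun t => t.size = n ∧ t.varCount ≤ K

/-- Number of such classes computing a function of the class `⟨f⟩`. -/
noncomputable def TcountClass (n K : ℕ) (f : (ℕ → Bool) → Bool) : ℕ :=
  classCount fun t => t.size = n ∧ t.varCount ≤ K ∧ FunEquiv t.eval f

/-- `P_n⟨f⟩`: the probability that a uniform equivalence class of trees of size
`n` (at most `K` variables) computes a function of `⟨f⟩`. -/
noncomputable def Pclass (n K : ℕ) (f : (ℕ → Bool) → Bool) : ℝ :=
  (TcountClass n K f : ℝ) / (Tcount n K : ℝ)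

/-- Number of classes of size `n`, at most `K` variables, computing exactly `f`. -/
noncomputable def TcountEval (n K : ℕ) (f : (ℕ → Bool) → Bool) : ℕ :=
  classCount fun t => t.size = n ∧ t.varCount ≤ K ∧ t.eval = f

/-- Stirling numbers of the second kind. -/
def stirling : ℕ → ℕ → ℕ
  | 0, 0 => 1
  | 0, _ + 1 => 0
  | _ + 1, 0 => 0
  | n + 1, k + 1 => (k + 1) * stirling n (k + 1) + stirling n k

/-- `B n k = Σ_{p=1}^{k} S(n,p)·2^{−p}`. -/
noncomputable def B (n k : ℕ) : ℝ :=
  ∑ p ∈ Finset.Icc 1 k, (stirling n p : ℝ) / 2 ^ p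

/-- `a n p = p^n/(p!·2^p)`. -/
noncomputable def a (n p : ℕ) : ℝ :=
  (p : ℝ) ^ n / ((Nat.factorial p : ℝ) * 2 ^ p)

/-- `rat_n = B_{n−1,k_n}/B_{n,k_n}`. -/
noncomputable def rat (k : ℕ → ℕ) (n : ℕ) : ℝ := B (n - 1) (k n) / B n (k n)

/-- The complexity `L(f)`: minimal size of an and/or tree computing `f`. -/
noncomputable def complexity (f : (ℕ → Bool) → Bool) : ℕ :=
  sInf {m | ∃ t : AOTree, t.size = m ∧ t.eval = f}

/-- The variable `x_i` is essential for `f`. -/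
def Essential (i : ℕ) (f : (ℕ → Bool) → Bool) : Prop :=
  ∃ x : ℕ → Bool, f (Function.update x i false) ≠ f (Function.update x i true)

/-- `E(f)`: the number of essential variables of `f`. -/
noncomputable def essCount (f : (ℕ → Bool) → Bool) : ℕ :=
  Nat.card {i : ℕ // Essential i f}

/-- The multiplicity `R⟨f⟩ = L⟨f⟩ − E⟨f⟩`. -/
noncomputable def mult (f : (ℕ → Bool) → Bool) : ℕ := complexity f - essCount f

/-- `M` is, for each `n ≥ 1`, an index of `{1,…,n}` maximizing `p ↦ p^n/(p!·2^p)`. -/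
def IsArgmax (M : ℕ → ℕ) : Prop :=
  ∀ n, 1 ≤ n → M n ∈ Finset.Icc 1 n ∧ ∀ p ∈ Finset.Icc 1 n, a n p ≤ a n (M n)

/-- There is a leaf labelled by the given literal linked to the root by
`∨`-labelled internal nodes only. -/
def orLeaf : AOTree → ℕ × Bool → Prop
  | .leaf v b, l => (v, b) = l
  | .node .or A B, l => orLeaf A l ∨ orLeaf B l
  | .node .and _ _, _ => False

/-- There is a leaf labelled by the given literal linked to the root by
`∧`-labelled internal nodes only. -/
def andLeaf : AOTree → ℕ × Bool → Prop
  | .leaf v b, l => (v, b) = l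
  | .node .and A B, l => andLeaf A l ∨ andLeaf B l
  | .node .or _ _, _ => False

/-- A simple tautology: two leaves labelled by a variable and its negation,
both linked to the root through `∨`-connectives only. -/
def IsSimpleTautology (t : AOTree) : Prop :=
  ∃ v b, orLeaf t (v, b) ∧ orLeaf t (v, !b)

/-- A simple contradiction: the dual notion. -/
def IsSimpleContradiction (t : AOTree) : Prop :=
  ∃ v b, andLeaf t (v, b) ∧ andLeaf t (v, !b)

/-- A tautology: a tree computing the constant function `true`. -/
def IsTautology (t : AOTree) : Prop := ∀ x : ℕ → Bool, t.eval x = true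

/-- A simple-x of type T: one subtree of the root is a single leaf, the other
is a simple tautology if the root is `∧`, a simple contradiction if it is `∨`. -/
def IsSimpleXT (t : AOTree) : Prop :=
  (∃ v b s, (t = .node .and (.leaf v b) s ∨ t = .node .and s (.leaf v b)) ∧
    IsSimpleTautology s) ∨
  (∃ v b s, (t = .node .or (.leaf v b) s ∨ t = .node .or s (.leaf v b)) ∧
    IsSimpleContradiction s)

/-- A simple-x of type X: one subtree of the root is a single leaf `ℓ`, the root
is `∧` (resp. `∨`), and the other subtree has a leaf labelled by the literal of
`ℓ` linked to its root by `∨`-only (resp. `∧`-only) internal nodes. -/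
def IsSimpleXX (t : AOTree) : Prop :=
  (∃ v b s, (t = .node .and (.leaf v b) s ∨ t = .node .and s (.leaf v b)) ∧
    orLeaf s (v, b)) ∨
  (∃ v b s, (t = .node .or (.leaf v b) s ∨ t = .node .or s (.leaf v b)) ∧
    andLeaf s (v, b))

section

open Finset

/-- The opposite of a literal. -/
def negLit (x : ℕ × Bool) : ℕ × Bool := (x.1, !x.2)

lemma eq_negLit_iff (x y : ℕ × Bool) : x = negLit y ↔ x.1 = y.1 ∧ x ≠ y := by
  obtain ⟨a, b⟩ := x
  obtain ⟨c, d⟩ := y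
  cases b <;> cases d <;> simp [negLit]

/-- The relations of having the same variable and the same literal, on `n` positions, bundled. -/
abbrev Code (n : ℕ) : Type := Fin n → Fin n → Prop × Prop

/-- The code of a labelling of `n` positions by literals. -/
def code {n : ℕ} (f : Fin n → ℕ × Bool) : Code n :=
  fun i j => ((f i).1 = (f j).1, f i = f j)

/-- The set of variables used by a labelling. -/
def vars {n : ℕ} (f : Fin n → ℕ × Bool) : Finset ℕ := univ.image fun i => (f i).1

lemma mem_vars {n : ℕ} {f : Fin n → ℕ × Bool} {v : ℕ} : v ∈ vars f ↔ ∃ i, (f i).1 = v := by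
  simp [vars]

lemma code_eq_iff {n : ℕ} {f g : Fin n → ℕ × Bool} :
    code f = code g ↔ ∀ i j, ((f i).1 = (f j).1 ↔ (g i).1 = (g j).1) ∧ (f i = f j ↔ g i = g j) := by
  simp only [funext_iff, code, Prod.mk.injEq, eq_iff_iff]

lemma card_vars_le_of_code_eq {n : ℕ} {f g : Fin n → ℕ × Bool} (h : code f = code g) :
    #(vars g) ≤ #(vars f) := by
  classical
  rw [code_eq_iff] at h
  let φ : ℕ → ℕ := fun v => if hv : ∃ i, (f i).1 = v then (g hv.choose).1 else 0
  have hφ : vars g ⊆ (vars f).image φ := by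
    intro v hv
    obtain ⟨i, rfl⟩ := mem_vars.1 hv
    refine mem_image.2 ⟨(f i).1, mem_vars.2 ⟨i, rfl⟩, ?_⟩
    have hi : ∃ j, (f j).1 = (f i).1 := ⟨i, rfl⟩
    simp only [φ, dif_pos hi]
    exact (h _ _).1.1 hi.choose_spec
  exact (card_le_card hφ).trans card_image_le

lemma card_vars_eq_of_code_eq {n : ℕ} {f g : Fin n → ℕ × Bool} (h : code f = code g) :
    #(vars f) = #(vars g) :=
  le_antisymm (card_vars_le_of_code_eq h.symm) (card_vars_le_of_code_eq h)

open Classical in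
/-- Codes of the labellings using exactly `p` variables. -/
noncomputable def codesEq (n p : ℕ) : Finset (Code n) :=
  univ.filter fun c => ∃ f, code f = c ∧ #(vars f) = p

open Classical in
/-- Codes of the labellings using at most `K` variables. -/
noncomputable def codesLE (n K : ℕ) : Finset (Code n) :=
  univ.filter fun c => ∃ f, code f = c ∧ #(vars f) ≤ K

lemma mem_codesEq {n p : ℕ} {c : Code n} : c ∈ codesEq n p ↔ ∃ f, code f = c ∧ #(vars f) = p := by
  simp [codesEq]

lemma mem_codesLE {n K : ℕ} {c : Code n} : c ∈ codesLE n K ↔ ∃ f, code f = c ∧ #(vars f) ≤ K := by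
  simp [codesLE]

/-- Deleting the position `j` from a code. -/
def del {n : ℕ} (j : Fin (n + 1)) (c : Code (n + 1)) : Code n :=
  fun a b => c (j.succAbove a) (j.succAbove b)

lemma del_code {n : ℕ} (j : Fin (n + 1)) (f : Fin (n + 1) → ℕ × Bool) :
    del j (code f) = code fun a => f (j.succAbove a) := rfl

lemma vars_eq_insert {n : ℕ} (j : Fin (n + 1)) (f : Fin (n + 1) → ℕ × Bool) :
    vars f = insert (f j).1 (vars fun a => f (j.succAbove a)) := by
  ext v
  simp only [mem_vars, mem_insert]
  constructor
  · rintro ⟨i, rfl⟩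
    rcases eq_or_ne i j with rfl | h
    · exact Or.inl rfl
    · obtain ⟨a, rfl⟩ := Fin.exists_succAbove_eq h
      exact Or.inr ⟨a, rfl⟩
  · rintro (rfl | ⟨a, rfl⟩)
    exacts [⟨_, rfl⟩, ⟨_, rfl⟩]

/-- A code is determined by its restriction and the row of the deleted position. -/
lemma code_eq_of_del_eq {n : ℕ} {j : Fin (n + 1)} {f g : Fin (n + 1) → ℕ × Bool}
    (h : del j (code f) = del j (code g))
    (hj : ∀ a, ((f j).1 = (f (j.succAbove a)).1 ↔ (g j).1 = (g (j.succAbove a)).1) ∧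
      (f j = f (j.succAbove a) ↔ g j = g (j.succAbove a))) : code f = code g := by
  rw [del_code, del_code, code_eq_iff] at h
  rw [code_eq_iff]
  intro a b
  rcases eq_or_ne a j with rfl | ha
  · rcases eq_or_ne b a with rfl | hb
    · simp
    · obtain ⟨b, rfl⟩ := Fin.exists_succAbove_eq hb
      exact hj b
  · obtain ⟨a, rfl⟩ := Fin.exists_succAbove_eq ha
    rcases eq_or_ne b j with rfl | hb
    · rw [eq_comm (a := (f _).1), eq_comm (a := (g _).1), eq_comm (a := f _), eq_comm (a := g _)]
      exact hj a
    · obtain ⟨b, rfl⟩ := Fin.exists_succAbove_eq hb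
      exact h a b

/-- Two positions carry opposite literals. -/
def Opp {n : ℕ} (c : Code n) (i j : Fin n) : Prop := (c i j).1 ∧ ¬ (c i j).2

lemma opp_code_iff {n : ℕ} {f : Fin n → ℕ × Bool} {i j : Fin n} :
    Opp (code f) i j ↔ f i = negLit (f j) := by
  rw [eq_negLit_iff]; rfl

lemma opp_code_comm {n : ℕ} {f : Fin n → ℕ × Bool} {i j : Fin n} :
    Opp (code f) i j ↔ Opp (code f) j i := by
  simp only [Opp, code]
  rw [eq_comm, eq_comm (a := f i)]

open Classical in
lemma card_opp_del {n K : ℕ} (Q : Code n → Prop) (i : Fin n) (j : Fin (n + 1)) :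
    #((codesLE (n + 1) K).filter fun c => Opp c j (j.succAbove i) ∧ Q (del j c)) =
      #((codesLE n K).filter Q) := by
  refine card_bij (fun c _ => del j c) ?_ ?_ ?_
  · intro c hc
    simp only [mem_filter, mem_codesLE] at hc ⊢
    obtain ⟨⟨f, rfl, hf⟩, -, hQ⟩ := hc
    refine ⟨⟨_, rfl, le_trans (card_le_card ?_) hf⟩, hQ⟩
    rw [vars_eq_insert j f]
    exact subset_insert _ _
  · intro c hc c' hc' h
    simp only [mem_filter, mem_codesLE] at hc hc'
    obtain ⟨⟨f, rfl, hf⟩, ho, -⟩ := hc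
    obtain ⟨⟨g, rfl, hg⟩, ho', -⟩ := hc'
    refine code_eq_of_del_eq h fun a => ?_
    rw [opp_code_iff] at ho ho'
    rw [del_code, del_code, code_eq_iff] at h
    have h1 := h i a
    rw [ho, ho', eq_comm (a := negLit _), eq_comm (a := negLit _), eq_negLit_iff, eq_negLit_iff]
    simp only [negLit, ne_eq]
    rw [eq_comm (a := f _), eq_comm (a := g _), eq_comm (b := (f (j.succAbove i)).1),
      eq_comm (b := (g (j.succAbove i)).1), h1.1, h1.2]
    simp
  · intro c hc
    simp only [mem_filter, mem_codesLE] at hc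
    obtain ⟨⟨g, rfl, hg⟩, hQ⟩ := hc
    have hd : del j (code (j.insertNth (negLit (g i)) g : Fin (n + 1) → ℕ × Bool)) = code g := by
      rw [del_code]; simp
    refine ⟨code (j.insertNth (negLit (g i)) g : Fin (n + 1) → ℕ × Bool), ?_, hd⟩
    rw [mem_filter, mem_codesLE, opp_code_iff, hd]
    refine ⟨⟨_, rfl, ?_⟩, by simp, hQ⟩
    rw [vars_eq_insert j]
    simp only [Fin.insertNth_apply_same, Fin.insertNth_apply_succAbove]
    rwa [insert_eq_of_mem (show (negLit (g i)).1 ∈ vars g from mem_vars.2 ⟨i, rfl⟩)]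

open Classical in
lemma card_opp {n K : ℕ} {i j : Fin (n + 1)} (h : i ≠ j) :
    #((codesLE (n + 1) K).filter fun c => Opp c i j) = #(codesLE n K) := by
  obtain ⟨a, rfl⟩ := Fin.exists_succAbove_eq h.symm
  simpa using card_opp_del (K := K) (fun _ => True) a i

open Classical in
lemma card_opp_opp_of_ne {n K : ℕ} {i j i' j' : Fin (n + 2)} (h : i ≠ j) (h' : i' ≠ j')
    (hi : i ≠ i') (hj : i ≠ j') :
    #((codesLE (n + 2) K).filter fun c => Opp c i j ∧ Opp c i' j') = #(codesLE n K) := by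
  obtain ⟨a, rfl⟩ := Fin.exists_succAbove_eq h.symm
  obtain ⟨b, rfl⟩ := Fin.exists_succAbove_eq hi.symm
  obtain ⟨d, rfl⟩ := Fin.exists_succAbove_eq hj.symm
  have hbd : b ≠ d := fun e => h' (by rw [e])
  rw [← card_opp (K := K) hbd]
  exact card_opp_del (K := K) (fun c => Opp c b d) a i

open Classical in
lemma card_opp_opp {n K : ℕ} {i j i' j' : Fin (n + 2)} (h : i < j) (h' : i' < j')
    (hne : (i, j) ≠ (i', j')) :
    #((codesLE (n + 2) K).filter fun c => Opp c i j ∧ Opp c i' j') = #(codesLE n K) := by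
  by_cases hi : i ≠ i' ∧ i ≠ j'
  · exact card_opp_opp_of_ne h.ne h'.ne hi.1 hi.2
  · have hj : j ≠ i' ∧ j ≠ j' := by
      constructor
      · rintro rfl
        apply hi
        exact ⟨h.ne, (h.trans h').ne⟩
      · rintro rfl
        apply hi
        exact ⟨fun e => hne (by rw [e]), h.ne⟩
    rw [← card_opp_opp_of_ne (K := K) h.ne' h'.ne hj.1 hj.2]
    congr 1
    refine filter_congr fun c hc => ?_
    obtain ⟨f, rfl, -⟩ := mem_codesLE.1 hc
    rw [opp_code_comm]

lemma card_codesLE (n K : ℕ) : #(codesLE n K) = ∑ p ∈ range (K + 1), #(codesEq n p) := by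
  classical
  rw [← card_biUnion]
  · congr 1
    ext c
    simp only [mem_codesLE, mem_biUnion, mem_codesEq, mem_range]
    constructor
    · rintro ⟨f, rfl, hf⟩
      exact ⟨_, by omega, f, rfl, rfl⟩
    · rintro ⟨p, hp, f, rfl, rfl⟩
      exact ⟨f, rfl, by omega⟩
  · intro p _ q _ hpq
    rw [Function.onFun, Finset.disjoint_left]
    intro c hc hc'
    obtain ⟨f, rfl, rfl⟩ := mem_codesEq.1 hc
    obtain ⟨g, hg, rfl⟩ := mem_codesEq.1 hc'
    exact hpq (card_vars_eq_of_code_eq hg).symm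

open Classical in
lemma card_codesEq_new (n p : ℕ) :
    #((codesEq (n + 1) (p + 1)).filter fun c => ¬ ∃ a, (c 0 (Fin.succAbove 0 a)).1) =
      #(codesEq n p) := by
  refine card_bij (fun c _ => del 0 c) ?_ ?_ ?_
  · intro c hc
    simp only [mem_filter, mem_codesEq] at hc ⊢
    obtain ⟨⟨f, rfl, hf⟩, hn⟩ := hc
    refine ⟨_, rfl, ?_⟩
    rw [vars_eq_insert 0 f, card_insert_of_notMem, Nat.add_right_cancel_iff] at hf
    · exact hf
    · intro hm
      obtain ⟨a, ha⟩ := mem_vars.1 hm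
      exact hn ⟨a, ha.symm⟩
  · intro c hc c' hc' h
    simp only [mem_filter, mem_codesEq] at hc hc'
    obtain ⟨⟨f, rfl, hf⟩, hn⟩ := hc
    obtain ⟨⟨g, rfl, hg⟩, hn'⟩ := hc'
    simp only [code, not_exists] at hn hn'
    refine code_eq_of_del_eq h fun a => ⟨iff_of_false (hn a) (hn' a), iff_of_false ?_ ?_⟩
    · exact fun e => hn a (by rw [e])
    · exact fun e => hn' a (by rw [e])
  · intro c hc
    obtain ⟨g, rfl, hg⟩ := mem_codesEq.1 hc
    obtain ⟨v, hv⟩ := Infinite.exists_notMem_finset (vars g)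
    have hd : del 0 (code (Fin.insertNth 0 (v, true) g : Fin (n + 1) → ℕ × Bool)) = code g := by
      rw [del_code]
      simp only [Fin.insertNth_apply_succAbove]
    refine ⟨_, ?_, hd⟩
    rw [mem_filter, mem_codesEq]
    refine ⟨⟨_, rfl, ?_⟩, ?_⟩
    · rw [vars_eq_insert 0]
      simp only [Fin.insertNth_apply_same, Fin.insertNth_apply_succAbove]
      rw [card_insert_of_notMem hv, hg]
    · rintro ⟨a, ha⟩
      simp only [code, Fin.insertNth_apply_same, Fin.insertNth_apply_succAbove] at ha
      exact hv (mem_vars.2 ⟨a, ha.symm⟩)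

open Classical in
lemma card_codesEq_old_fiber {n p : ℕ} {c₀ : Code n} (hc₀ : c₀ ∈ codesEq n p) :
    #(((codesEq (n + 1) p).filter fun c => ∃ a, (c 0 (Fin.succAbove 0 a)).1).filter
      fun c => del 0 c = c₀) = p * 2 := by
  obtain ⟨g, rfl, rfl⟩ := mem_codesEq.1 hc₀
  rw [← Fintype.card_bool, ← Finset.card_univ, ← card_product]
  symm
  have hd (x : ℕ × Bool) :
      del 0 (code (Fin.insertNth 0 x g : Fin (n + 1) → ℕ × Bool)) = code g := by
    rw [del_code]
    simp only [Fin.insertNth_apply_succAbove]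
  refine card_bij (fun x _ => code (Fin.insertNth 0 x g : Fin (n + 1) → ℕ × Bool)) ?_ ?_ ?_
  · intro x hx
    have hx1 := (mem_product.1 hx).1
    rw [mem_filter, mem_filter, mem_codesEq, hd]
    refine ⟨⟨⟨_, rfl, ?_⟩, ?_⟩, rfl⟩
    · rw [vars_eq_insert 0]
      simp only [Fin.insertNth_apply_same, Fin.insertNth_apply_succAbove]
      rw [insert_eq_of_mem hx1]
    · obtain ⟨a, ha⟩ := mem_vars.1 hx1
      refine ⟨a, ?_⟩
      simp only [code, Fin.insertNth_apply_same, Fin.insertNth_apply_succAbove]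
      exact ha.symm
  · intro x hx y hy h
    obtain ⟨a, ha⟩ := mem_vars.1 (mem_product.1 hx).1
    rw [code_eq_iff] at h
    have h1 := h 0 (Fin.succAbove 0 a)
    simp only [Fin.insertNth_apply_same, Fin.insertNth_apply_succAbove] at h1
    have h2 : y.1 = (g a).1 := h1.1.1 ha.symm
    have h3 := h1.2
    obtain ⟨x1, x2⟩ := x
    obtain ⟨y1, y2⟩ := y
    generalize g a = z at *
    obtain ⟨z1, z2⟩ := z
    simp only at ha h2
    subst ha h2
    revert h3
    cases x2 <;> cases y2 <;> cases z2 <;> simp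
  · intro c hc
    simp only [mem_filter, mem_codesEq] at hc
    obtain ⟨⟨⟨f, rfl, hf⟩, a, ha⟩, hdf⟩ := hc
    simp only [code] at ha
    let x : ℕ × Bool := if f 0 = f (Fin.succAbove 0 a) then g a else negLit (g a)
    have hx1 : x.1 = (g a).1 := by
      simp only [x]; split_ifs <;> rfl
    refine ⟨x, mem_product.2 ⟨mem_vars.2 ⟨a, hx1.symm⟩, mem_univ _⟩, ?_⟩
    refine code_eq_of_del_eq ((hd x).trans hdf.symm) fun b => ?_
    rw [del_code, code_eq_iff] at hdf
    simp only [Fin.insertNth_apply_same, Fin.insertNth_apply_succAbove]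
    have h1 := hdf a b
    rw [hx1, ha]
    refine ⟨h1.1.symm, ?_⟩
    by_cases h0 : f 0 = f (Fin.succAbove 0 a)
    · simp only [x, if_pos h0]
      rw [h0]
      exact h1.2.symm
    · have h0' := (eq_negLit_iff _ _).2 ⟨ha, h0⟩
      simp only [x, if_neg h0]
      rw [h0', eq_comm (a := negLit _), eq_comm (a := negLit _), eq_negLit_iff, eq_negLit_iff,
        eq_comm (b := (g a).1), eq_comm (b := (f _).1), ne_comm, ne_comm (a := f _), h1.1, ne_eq,
        ne_eq, h1.2]

lemma card_codesEq_succ (n p : ℕ) :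
    #(codesEq (n + 1) (p + 1)) = 2 * (p + 1) * #(codesEq n (p + 1)) + #(codesEq n p) := by
  classical
  rw [← card_filter_add_card_filter_not (s := codesEq (n + 1) (p + 1))
    (fun c => ∃ a, (c 0 (Fin.succAbove 0 a)).1), card_codesEq_new]
  congr 1
  rw [card_eq_sum_card_fiberwise (f := del 0) (t := codesEq n (p + 1))]
  · rw [sum_congr rfl fun c hc => card_codesEq_old_fiber hc, sum_const, smul_eq_mul]
    ring
  · intro c hc
    simp only [coe_filter, Set.mem_ofPred_eq, mem_codesEq] at hc
    obtain ⟨⟨f, rfl, hf⟩, a, ha⟩ := hc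
    simp only [code] at ha
    refine mem_coe.2 (mem_codesEq.2 ⟨_, rfl, ?_⟩)
    rwa [vars_eq_insert 0 f, insert_eq_of_mem (mem_vars.2 ⟨a, ha.symm⟩)] at hf

lemma two_pow_mul_card_codesEq (n p : ℕ) : 2 ^ p * #(codesEq n p) = stirling n p * 2 ^ n := by
  induction n generalizing p with
  | zero =>
    cases p with
    | zero =>
      have : codesEq 0 0 = univ := by
        ext c
        simp only [mem_codesEq, mem_univ, iff_true]
        exact ⟨fun i => i.elim0, Subsingleton.elim _ _, by simp [vars]⟩
      rw [this]
      simp [stirling]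
    | succ p =>
      have : codesEq 0 (p + 1) = ∅ := by
        ext c
        simp [mem_codesEq, vars]
      simp [this, stirling]
  | succ n ih =>
    cases p with
    | zero =>
      have : codesEq (n + 1) 0 = ∅ := by
        ext c
        simp [mem_codesEq, vars, univ_eq_empty_iff]
      simp [this, stirling]
    | succ p =>
      rw [card_codesEq_succ, stirling]
      have h1 := ih (p + 1)
      have h2 := ih p
      calc 2 ^ (p + 1) * (2 * (p + 1) * #(codesEq n (p + 1)) + #(codesEq n p))
          = 2 * (p + 1) * (2 ^ (p + 1) * #(codesEq n (p + 1))) + 2 * (2 ^ p * #(codesEq n p)) := by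
            ring
        _ = _ := by rw [h1, h2]; ring

lemma card_codesLE_eq {n : ℕ} (hn : 1 ≤ n) (K : ℕ) : (#(codesLE n K) : ℝ) = 2 ^ n * B n K := by
  have h (p : ℕ) : (#(codesEq n p) : ℝ) = 2 ^ n * ((stirling n p : ℝ) / 2 ^ p) := by
    have := congrArg (Nat.cast : ℕ → ℝ) (two_pow_mul_card_codesEq n p)
    push_cast at this
    field_simp
    linarith
  rw [card_codesLE, B, mul_sum, Nat.cast_sum, sum_congr rfl fun p _ => h p, range_eq_Ico,
    sum_eq_sum_Ico_succ_bot (by omega)]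
  obtain ⟨m, rfl⟩ := Nat.exists_eq_add_of_le' hn
  simp only [stirling]
  simp only [Nat.cast_zero, zero_div, mul_zero, zero_add]
  rfl

/-- The increasing pairs of elements of `O`. -/
def ltPairs {n : ℕ} (O : Finset (Fin n)) : Finset (Fin n × Fin n) :=
  (O ×ˢ O).filter fun e => e.1 < e.2

lemma card_ltPairs {n : ℕ} (O : Finset (Fin n)) : #(ltPairs O) = (#O).choose 2 := by
  have h1 : #O.offDiag = #(ltPairs O) + #(ltPairs O) := by
    have hs : #((O ×ˢ O).filter fun e => e.2 < e.1) = #(ltPairs O) := by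
      refine card_bij (fun e _ => e.swap) ?_ ?_ ?_
      · simp +contextual [ltPairs]
      · intro a _ b _ h
        exact Prod.swap_injective h
      · intro b hb
        refine ⟨b.swap, ?_, by simp⟩
        simp only [ltPairs, mem_filter, mem_product] at hb ⊢
        exact ⟨hb.1.symm, hb.2⟩
    nth_rewrite 2 [← hs]
    rw [ltPairs, ← card_union_of_disjoint]
    · congr 1
      ext e
      simp only [mem_offDiag, mem_union, mem_filter, mem_product]
      have := lt_or_lt_iff_ne (a := e.1) (b := e.2)
      tauto
    · rw [disjoint_filter]
      intro e _ h
      exact h.not_gt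
  rw [offDiag_card] at h1
  rw [Nat.choose_two_right, Nat.mul_sub, mul_one, h1]
  omega

open Classical in
/-- The codes in which two positions of `O` carry opposite literals. -/
noncomputable def oppCodes {n : ℕ} (K : ℕ) (O : Finset (Fin n)) : Finset (Code n) :=
  (codesLE n K).filter fun c => ∃ i ∈ O, ∃ j ∈ O, Opp c i j

lemma mem_oppCodes {n K : ℕ} {O : Finset (Fin n)} {c : Code n} :
    c ∈ oppCodes K O ↔ c ∈ codesLE n K ∧ ∃ e ∈ ltPairs O, Opp c e.1 e.2 := by
  simp only [oppCodes, mem_filter, and_congr_right_iff]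
  intro hc
  obtain ⟨f, rfl, -⟩ := mem_codesLE.1 hc
  constructor
  · rintro ⟨i, hi, j, hj, h⟩
    rcases lt_trichotomy i j with hij | rfl | hij
    · exact ⟨(i, j), by simp [ltPairs, *], h⟩
    · exact absurd rfl h.2
    · exact ⟨(j, i), by simp [ltPairs, *], opp_code_comm.1 h⟩
  · rintro ⟨⟨i, j⟩, he, h⟩
    simp only [ltPairs, mem_filter, mem_product] at he
    exact ⟨i, he.1.1, j, he.1.2, h⟩

lemma card_oppCodes_le {n K : ℕ} (O : Finset (Fin (n + 1))) :
    #(oppCodes K O) ≤ (#O).choose 2 * #(codesLE n K) := by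
  classical
  have hsub : oppCodes K O ⊆
      (ltPairs O).biUnion fun e => (codesLE (n + 1) K).filter fun c => Opp c e.1 e.2 := by
    intro c hc
    obtain ⟨h, e, he, ho⟩ := mem_oppCodes.1 hc
    exact mem_biUnion.2 ⟨e, he, mem_filter.2 ⟨h, ho⟩⟩
  refine (card_le_card hsub).trans (card_biUnion_le.trans ?_)
  rw [← card_ltPairs]
  refine sum_le_card_nsmul _ _ _ fun e he => ?_
  rw [card_opp (mem_filter.1 he).2.ne]

open Classical in
lemma card_filter_le_ite_add {α : Type*} (E : Finset α) (p : α → Prop) :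
    #(E.filter p) ≤ (if ∃ e ∈ E, p e then 1 else 0) +
      #(E.offDiag.filter fun x => p x.1 ∧ p x.2) := by
  have h : E.offDiag.filter (fun x => p x.1 ∧ p x.2) = (E.filter p).offDiag := by
    ext x
    simp only [mem_filter, mem_offDiag]
    tauto
  rw [h, offDiag_card]
  split_ifs with he
  · generalize #(E.filter p) = x
    rcases x with _ | x
    · omega
    · have : (x + 1) * (x + 1) = x * x + x + (x + 1) := by ring
      rw [this, Nat.add_sub_cancel]
      nlinarith
  · have : E.filter p = ∅ := by
      ext e
      simp only [mem_filter, notMem_empty, iff_false]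
      exact fun hh => he ⟨e, hh⟩
    simp [this]

lemma le_card_oppCodes {n K : ℕ} (O : Finset (Fin (n + 2))) :
    (#O).choose 2 * #(codesLE (n + 1) K) ≤
      #(oppCodes K O) + #(ltPairs O).offDiag * #(codesLE n K) := by
  classical
  have h1 : (#O).choose 2 * #(codesLE (n + 1) K) =
      ∑ c ∈ codesLE (n + 2) K, #((ltPairs O).filter fun e => Opp c e.1 e.2) := by
    rw [← card_ltPairs, ← smul_eq_mul, ← sum_const]
    simp_rw [card_filter]
    rw [sum_comm]
    refine sum_congr rfl fun e he => ?_
    rw [← card_filter, card_opp (mem_filter.1 he).2.ne]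
  have h2 : #(oppCodes K O) =
      ∑ c ∈ codesLE (n + 2) K, if ∃ e ∈ ltPairs O, Opp c e.1 e.2 then 1 else 0 := by
    rw [← card_filter]
    congr 1
    ext c
    rw [mem_oppCodes, mem_filter]
  have h3 : #(ltPairs O).offDiag * #(codesLE n K) =
      ∑ c ∈ codesLE (n + 2) K,
        #((ltPairs O).offDiag.filter fun x => Opp c x.1.1 x.1.2 ∧ Opp c x.2.1 x.2.2) := by
    rw [← smul_eq_mul, ← sum_const]
    simp_rw [card_filter]
    rw [sum_comm]
    refine sum_congr rfl fun x hx => ?_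
    rw [mem_offDiag] at hx
    rw [← card_filter, card_opp_opp (mem_filter.1 hx.1).2 (mem_filter.1 hx.2.1).2 hx.2.2]
  rw [h1, h2, h3, ← sum_add_distrib]
  exact sum_le_sum fun c _ => card_filter_le_ite_add _ _

lemma self_mul_self_eq_choose (r : ℕ) : r * r = r + 2 * r.choose 2 := by
  induction r with
  | zero => simp
  | succ r ih =>
    simp only [Nat.choose_succ_succ' r 1, Nat.choose_one_right, Nat.reduceAdd]
    nlinarith

lemma self_mul_choose_two (r : ℕ) : r * r.choose 2 = 2 * r.choose 2 + 3 * r.choose 3 := by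
  induction r with
  | zero => simp
  | succ r ih =>
    have e := self_mul_self_eq_choose r
    simp only [Nat.choose_succ_succ' r 2, Nat.choose_succ_succ' r 1, Nat.choose_one_right,
      Nat.reduceAdd]
    nlinarith

lemma choose_two_mul_self (r : ℕ) :
    r.choose 2 * r.choose 2 = r.choose 2 + 6 * (r.choose 3 + r.choose 4) := by
  induction r with
  | zero => simp
  | succ r ih =>
    have e := self_mul_self_eq_choose r
    have e' := self_mul_choose_two r
    simp only [Nat.choose_succ_succ' r 3, Nat.choose_succ_succ' r 2, Nat.choose_succ_succ' r 1,
      Nat.choose_one_right, Nat.reduceAdd]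
    nlinarith

lemma card_offDiag_ltPairs {n : ℕ} (O : Finset (Fin n)) :
    #(ltPairs O).offDiag = 6 * ((#O).choose 3 + (#O).choose 4) := by
  rw [offDiag_card, card_ltPairs, choose_two_mul_self]
  omega

lemma Shape.one_le_size (s : Shape) : 1 ≤ s.size := by
  cases s with
  | leaf => exact le_rfl
  | node c l r =>
    have := l.one_le_size
    simp only [Shape.size]
    omega

lemma AOTree.length_leaves (t : AOTree) : t.leaves.length = t.shape.size := by
  induction t with
  | leaf v b => rfl
  | node c l r ihl ihr => simp [AOTree.leaves, AOTree.shape, Shape.size, ihl, ihr]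

lemma exists_tree_of_shape (s : Shape) (L : List (ℕ × Bool)) (h : L.length = s.size) :
    ∃ t : AOTree, t.shape = s ∧ t.leaves = L := by
  induction s generalizing L with
  | leaf =>
    obtain ⟨⟨v, b⟩, rfl⟩ := List.length_eq_one_iff.1 h
    exact ⟨.leaf v b, rfl, rfl⟩
  | node c l r ihl ihr =>
    simp only [Shape.size] at h
    obtain ⟨t, ht, ht'⟩ := ihl (L.take l.size) (by simp; omega)
    obtain ⟨u, hu, hu'⟩ := ihr (L.drop l.size) (by simp; omega)
    exact ⟨.node c t u, by simp [AOTree.shape, ht, hu], by simp [AOTree.leaves, ht', hu']⟩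

/-- The labelling of the first `n` leaves of a tree. -/
def labels (n : ℕ) (t : AOTree) : Fin n → ℕ × Bool := fun i => lv t i

lemma exists_tree_of_labels {n : ℕ} {s : Shape} (hs : s.size = n) (f : Fin n → ℕ × Bool) :
    ∃ t : AOTree, t.shape = s ∧ labels n t = f := by
  obtain ⟨t, ht, ht'⟩ := exists_tree_of_shape s (List.ofFn f) (by simp [hs])
  refine ⟨t, ht, ?_⟩
  ext1 i
  simp [labels, lv, ht']

lemma AOTree.varCount_eq {n : ℕ} {t : AOTree} (ht : t.size = n) :
    t.varCount = #(vars (labels n t)) := by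
  subst ht
  unfold AOTree.varCount
  congr 1
  ext v
  simp only [List.mem_toFinset, List.mem_map, mem_vars, labels, lv]
  constructor
  · rintro ⟨x, hx, rfl⟩
    obtain ⟨i, hi, rfl⟩ := List.mem_iff_getElem.1 hx
    exact ⟨⟨i, hi⟩, by simp [hi]⟩
  · rintro ⟨⟨i, hi⟩, rfl⟩
    have hi' : i < t.leaves.length := hi
    exact ⟨t.leaves[i], by simp, by simp [hi']⟩

/-- The tree-structure of a tree together with the code of its labelling. -/
def treeCode (n : ℕ) (t : AOTree) : Shape × Code n := (t.shape, code (labels n t))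

lemma treeEquiv_iff {n : ℕ} {A B : AOTree} (hA : A.size = n) :
    TreeEquiv A B ↔ treeCode n A = treeCode n B := by
  subst hA
  simp only [TreeEquiv, treeCode, Prod.mk.injEq, code_eq_iff, labels]
  refine and_congr_right fun _ => ⟨fun h i j => h i j i.2 j.2, fun h i j hi hj => ?_⟩
  exact h ⟨i, hi⟩ ⟨j, hj⟩

lemma classCount_eq_ncard {n : ℕ} {P : AOTree → Prop} (hP : ∀ t, P t → t.size = n) :
    classCount P = (treeCode n '' {t | P t}).ncard := by
  rw [classCount, ← Nat.card_coe_set_eq]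
  refine Nat.card_eq_of_bijective
    (Quot.lift (fun t => (⟨treeCode n t.1, t.1, t.2, rfl⟩ : treeCode n '' {t | P t})) ?_) ⟨?_, ?_⟩
  · intro A B h
    exact Subtype.ext ((treeEquiv_iff (hP _ A.2)).1 h)
  · rintro ⟨A⟩ ⟨B⟩ h
    exact Quot.sound ((treeEquiv_iff (hP _ A.2)).2 (Subtype.ext_iff.1 h))
  · rintro ⟨_, t, ht, rfl⟩
    exact ⟨Quot.mk _ ⟨t, ht⟩, rfl⟩

/-- Positions of the leaves linked to the root by `∨`-labelled nodes only. -/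
def orPos : Shape → Finset ℕ
  | .leaf => {0}
  | .node .or l r => orPos l ∪ (orPos r).map (addLeftEmbedding l.size)
  | .node .and _ _ => ∅

/-- Number of leaves linked to the root by `∨`-labelled nodes only. -/
def orCount : Shape → ℕ
  | .leaf => 1
  | .node .or l r => orCount l + orCount r
  | .node .and _ _ => 0

lemma lt_size_of_mem_orPos {s : Shape} {i : ℕ} (h : i ∈ orPos s) : i < s.size := by
  induction s generalizing i with
  | leaf =>
    simp only [orPos, mem_singleton] at h
    simp [h, Shape.size]
  | node c l r ihl ihr =>
    cases c with
    | and => simp [orPos] at h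
    | or =>
      simp only [orPos, mem_union, Finset.mem_map, addLeftEmbedding_apply] at h
      simp only [Shape.size]
      rcases h with h | ⟨j, h, rfl⟩
      · exact (ihl h).trans_le (Nat.le_add_right _ _)
      · exact Nat.add_lt_add_left (ihr h) _

lemma card_orPos (s : Shape) : #(orPos s) = orCount s := by
  induction s with
  | leaf => simp [orPos, orCount]
  | node c l r ihl ihr =>
    cases c with
    | and => simp [orPos, orCount]
    | or =>
      rw [orPos, card_union_of_disjoint, card_map, ihl, ihr, orCount]
      rw [Finset.disjoint_left]
      intro i hi hi'
      obtain ⟨j, -, rfl⟩ := Finset.mem_map.1 hi'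
      have := lt_size_of_mem_orPos hi
      simp at this

lemma orLeaf_iff (t : AOTree) (x : ℕ × Bool) :
    orLeaf t x ↔ ∃ i ∈ orPos t.shape, lv t i = x := by
  induction t with
  | leaf v b => simp [orLeaf, orPos, AOTree.shape, lv, AOTree.leaves]
  | node c l r ihl ihr =>
    cases c with
    | and => simp [orLeaf, orPos, AOTree.shape]
    | or =>
      simp only [orLeaf, orPos, AOTree.shape, ihl, ihr, mem_union, Finset.mem_map,
        addLeftEmbedding_apply, or_and_right, exists_or, exists_exists_and_eq_and]
      refine or_congr (exists_congr fun i => and_congr_right fun hi => ?_)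
        (exists_congr fun i => and_congr_right fun hi => ?_)
      · have := lt_size_of_mem_orPos hi
        rw [← AOTree.length_leaves] at this
        simp only [lv, AOTree.leaves]
        rw [List.getD_append _ _ _ _ this]
      · simp only [lv, AOTree.leaves]
        rw [List.getD_append_right _ _ _ _ (by simp [AOTree.length_leaves]),
          AOTree.length_leaves, Nat.add_sub_cancel_left]

/-- `orPos` as a set of elements of `Fin n`. -/
def orFin (n : ℕ) (s : Shape) : Finset (Fin n) := univ.filter fun i => (i : ℕ) ∈ orPos s

lemma card_orFin {n : ℕ} {s : Shape} (hs : s.size = n) : #(orFin n s) = orCount s := by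
  subst hs
  rw [← card_orPos]
  refine card_bij (fun i _ => (i : ℕ)) ?_ ?_ ?_
  · intro i hi
    exact (mem_filter.1 hi).2
  · intro i _ j _ h
    exact Fin.ext h
  · intro i hi
    exact ⟨⟨i, lt_size_of_mem_orPos hi⟩, by simp [orFin, hi], rfl⟩

lemma isSimpleTautology_iff {n : ℕ} {t : AOTree} (ht : t.size = n) :
    IsSimpleTautology t ↔
      ∃ i ∈ orFin n t.shape, ∃ j ∈ orFin n t.shape, Opp (code (labels n t)) i j := by
  subst ht
  simp only [IsSimpleTautology, orLeaf_iff, opp_code_iff, labels, orFin, mem_filter, mem_univ,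
    true_and]
  constructor
  · rintro ⟨v, b, ⟨i, hi, h⟩, j, hj, h'⟩
    have hl (a : ℕ) (ha : a ∈ orPos t.shape) : a < t.size :=
      (lt_size_of_mem_orPos ha).trans_eq t.length_leaves.symm
    refine ⟨⟨i, hl i hi⟩, hi, ⟨j, hl j hj⟩, hj, ?_⟩
    simp [h, h', negLit]
  · rintro ⟨i, hi, j, hj, h⟩
    refine ⟨(lv t i).1, (lv t i).2, ⟨i, hi, rfl⟩, j, hj, ?_⟩
    rw [h]
    simp [negLit]

lemma finite_size_le (n : ℕ) : {s : Shape | s.size ≤ n}.Finite := by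
  induction n with
  | zero =>
    convert Set.finite_empty
    ext s
    have := s.one_le_size
    simp
    omega
  | succ n ih =>
    refine (((ih.prod ih).image fun x => Shape.node .and x.1 x.2).union
      (((ih.prod ih).image fun x => Shape.node .or x.1 x.2).union
        (Set.finite_singleton Shape.leaf))).subset ?_
    intro s hs
    cases s with
    | leaf => simp
    | node c l r =>
      have hl := l.one_le_size
      have hr := r.one_le_size
      simp only [Shape.size, Set.mem_ofPred_eq] at hs
      have hl' : l.size ≤ n := by omega
      have hr' : r.size ≤ n := by omega
      cases c
      · exact Or.inl ⟨(l, r), ⟨hl', hr'⟩, rfl⟩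
      · exact Or.inr (Or.inl ⟨(l, r), ⟨hl', hr'⟩, rfl⟩)

/-- The tree-structures of size `n`. -/
noncomputable def shapes (n : ℕ) : Finset Shape :=
  (finite_size_le n).toFinset.filter fun s => s.size = n

lemma mem_shapes {n : ℕ} {s : Shape} : s ∈ shapes n ↔ s.size = n := by
  rw [shapes, mem_filter, Set.Finite.mem_toFinset, Set.mem_ofPred_eq]
  exact and_iff_right_of_imp le_of_eq

lemma Tcount_eq (n K : ℕ) : Tcount n K = #(shapes n) * #(codesLE n K) := by
  rw [Tcount, classCount_eq_ncard (n := n) fun t ht => ht.1, ← card_product,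
    ← Set.ncard_coe_finset]
  congr 1
  ext ⟨s, c⟩
  simp only [Set.mem_image, Set.mem_ofPred_eq, coe_product, Set.mem_prod, mem_coe, mem_shapes,
    mem_codesLE, treeCode, Prod.mk.injEq]
  constructor
  · rintro ⟨t, ⟨ht, hK⟩, rfl, rfl⟩
    exact ⟨t.length_leaves.symm.trans ht, _, rfl, by rwa [← t.varCount_eq ht]⟩
  · rintro ⟨hs, f, rfl, hf⟩
    obtain ⟨t, rfl, rfl⟩ := exists_tree_of_labels hs f
    have ht : t.size = n := t.length_leaves.trans hs
    exact ⟨t, ⟨ht, by rwa [t.varCount_eq ht]⟩, rfl, rfl⟩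

lemma classCount_simple_eq (n K : ℕ) :
    (classCount fun t => t.size = n ∧ t.varCount ≤ K ∧ IsSimpleTautology t) =
      ∑ s ∈ shapes n, #(oppCodes K (orFin n s)) := by
  classical
  have h : ∑ s ∈ shapes n, #(oppCodes K (orFin n s)) =
      #((shapes n ×ˢ codesLE n K).filter fun x =>
        ∃ i ∈ orFin n x.1, ∃ j ∈ orFin n x.1, Opp x.2 i j) := by
    rw [card_filter, sum_product]
    refine sum_congr rfl fun s _ => ?_
    rw [← card_filter, oppCodes]
  rw [h, classCount_eq_ncard (n := n) fun t ht => ht.1, ← Set.ncard_coe_finset]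
  congr 1
  ext ⟨s, c⟩
  simp only [Set.mem_image, Set.mem_ofPred_eq, mem_coe, mem_filter, mem_product, mem_shapes,
    mem_codesLE, treeCode, Prod.mk.injEq]
  constructor
  · rintro ⟨t, ⟨ht, hK, hT⟩, rfl, rfl⟩
    exact ⟨⟨t.length_leaves.symm.trans ht, _, rfl, by rwa [← t.varCount_eq ht]⟩,
      (isSimpleTautology_iff ht).1 hT⟩
  · rintro ⟨⟨hs, f, rfl, hf⟩, hT⟩
    obtain ⟨t, rfl, rfl⟩ := exists_tree_of_labels hs f
    have ht : t.size = n := t.length_leaves.trans hs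
    exact ⟨t, ⟨ht, by rwa [t.varCount_eq ht], (isSimpleTautology_iff ht).2 hT⟩, rfl, rfl⟩

lemma classCount_simple_le (n K : ℕ) :
    (classCount fun t => t.size = n + 1 ∧ t.varCount ≤ K ∧ IsSimpleTautology t) ≤
      (∑ s ∈ shapes (n + 1), (orCount s).choose 2) * #(codesLE n K) := by
  rw [classCount_simple_eq, sum_mul]
  refine sum_le_sum fun s hs => ?_
  rw [← card_orFin (mem_shapes.1 hs)]
  exact card_oppCodes_le _

lemma le_classCount_simple (n K : ℕ) :
    (∑ s ∈ shapes (n + 2), (orCount s).choose 2) * #(codesLE (n + 1) K) ≤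
      (classCount fun t => t.size = n + 2 ∧ t.varCount ≤ K ∧ IsSimpleTautology t) +
      6 * (∑ s ∈ shapes (n + 2), (orCount s).choose 3 +
        ∑ s ∈ shapes (n + 2), (orCount s).choose 4) * #(codesLE n K) := by
  rw [classCount_simple_eq, sum_mul, ← sum_add_distrib, mul_sum, sum_mul, ← sum_add_distrib]
  refine sum_le_sum fun s hs => ?_
  rw [← card_orFin (mem_shapes.1 hs), ← card_offDiag_ltPairs]
  exact le_card_oppCodes _

lemma sum_shapes (n : ℕ) (φ : Shape → ℝ) :
    ∑ s ∈ shapes n, φ s = (if n = 1 then φ .leaf else 0) +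
      ∑ p ∈ antidiagonal n, ∑ l ∈ shapes p.1, ∑ r ∈ shapes p.2, φ (.node .and l r) +
      ∑ p ∈ antidiagonal n, ∑ l ∈ shapes p.1, ∑ r ∈ shapes p.2, φ (.node .or l r) := by
  classical
  let S : Finset (Shape × Shape) := (antidiagonal n).biUnion fun p => shapes p.1 ×ˢ shapes p.2
  have hS (ψ : Shape × Shape → ℝ) : ∑ x ∈ S, ψ x =
      ∑ p ∈ antidiagonal n, ∑ l ∈ shapes p.1, ∑ r ∈ shapes p.2, ψ (l, r) := by
    rw [sum_biUnion]
    · simp_rw [sum_product]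
    · intro p _ q _ hpq
      rw [Function.onFun, Finset.disjoint_left]
      rintro ⟨l, r⟩ h h'
      simp only [mem_product, mem_shapes] at h h'
      exact hpq (Prod.ext (h.1.symm.trans h'.1) (h.2.symm.trans h'.2))
  have hmem (l r : Shape) : (l, r) ∈ S ↔ l.size + r.size = n := by
    simp only [S, mem_biUnion, HasAntidiagonal.mem_antidiagonal, mem_product, mem_shapes]
    exact ⟨fun ⟨p, hp, hl, hr⟩ => by omega, fun h => ⟨(l.size, r.size), h, rfl, rfl⟩⟩
  have hdecomp : shapes n = ((if n = 1 then {Shape.leaf} else ∅) ∪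
      S.image fun x => Shape.node .and x.1 x.2) ∪ S.image fun x => Shape.node .or x.1 x.2 := by
    ext s
    simp only [mem_union, mem_image, mem_shapes, Prod.exists, hmem]
    cases s with
    | leaf =>
      simp only [Shape.size]
      split_ifs with h
      · simp [h]
      · simp [eq_comm, h]
    | node c l r =>
      simp only [Shape.size]
      split_ifs with h <;> cases c <;> simp
  have hinj (c : Conn) : Set.InjOn (fun x : Shape × Shape => Shape.node c x.1 x.2) S := by
    rintro ⟨l, r⟩ _ ⟨l', r'⟩ _ h
    simpa using h
  rw [hdecomp, sum_union, sum_union, sum_image (hinj .and), sum_image (hinj .or), hS, hS]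
  · congr 2
    split_ifs <;> simp
  · rw [Finset.disjoint_left]
    intro s hs hs'
    obtain ⟨x, -, rfl⟩ := mem_image.1 hs'
    split_ifs at hs <;> simp at hs
  · rw [Finset.disjoint_left]
    intro s hs hs'
    obtain ⟨x, -, rfl⟩ := mem_image.1 hs'
    split_ifs at hs <;> simp at hs

/-- Generating function of the `j`-th factorial moments of `orCount`. -/
noncomputable def momentSeries (j : ℕ) : PowerSeries ℝ :=
  PowerSeries.mk fun n => ∑ s ∈ shapes n, ((orCount s).choose j : ℝ)

/-- Generating function of the tree-structures. -/
noncomputable def shapeSeries : PowerSeries ℝ := PowerSeries.mk fun n => (#(shapes n) : ℝ)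

lemma coeff_momentSeries (n j : ℕ) : PowerSeries.coeff n (momentSeries j) =
    ∑ s ∈ shapes n, ((orCount s).choose j : ℝ) := PowerSeries.coeff_mk _ _

lemma coeff_shapeSeries (n : ℕ) : PowerSeries.coeff n shapeSeries = #(shapes n) :=
  PowerSeries.coeff_mk _ _

lemma momentSeries_zero : momentSeries 0 = shapeSeries := by
  ext n
  simp [coeff_momentSeries, coeff_shapeSeries]

lemma momentSeries_eq (j : ℕ) : momentSeries j =
    ((1 : ℕ).choose j : ℝ) • PowerSeries.X + ((0 : ℕ).choose j : ℝ) • shapeSeries ^ 2 +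
      ∑ p ∈ antidiagonal j, momentSeries p.1 * momentSeries p.2 := by
  ext n
  rw [coeff_momentSeries, sum_shapes]
  simp only [map_add, map_sum, PowerSeries.coeff_smul, PowerSeries.coeff_X, pow_two,
    PowerSeries.coeff_mul, coeff_shapeSeries, coeff_momentSeries, orCount, smul_eq_mul]
  congr 1
  · congr 1
    · split_ifs <;> simp
    · simp only [sum_const, nsmul_eq_mul, mul_sum]
      refine sum_congr rfl fun p _ => ?_
      ring
  · rw [sum_comm]
    refine sum_congr rfl fun p _ => ?_
    simp only [Nat.add_choose_eq, Nat.cast_sum, Nat.cast_mul, sum_mul_sum]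
    rw [sum_comm]
    conv_rhs => rw [sum_comm]
    simp only [sum_comm (t := antidiagonal j)]
    exact sum_congr rfl fun y _ => sum_comm

lemma shapeSeries_eq : shapeSeries = PowerSeries.X + 2 * shapeSeries ^ 2 := by
  have h := momentSeries_eq 0
  simp only [Nat.antidiagonal_zero, sum_singleton, momentSeries_zero, Nat.choose_self, Nat.cast_one,
    one_smul, Nat.choose_zero_right] at h
  linear_combination h

lemma momentSeries_one : momentSeries 1 = shapeSeries := by
  have h := momentSeries_eq 1
  simp [Nat.antidiagonal_succ, momentSeries_zero] at h
  have hT := shapeSeries_eq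
  have : (momentSeries 1 - shapeSeries) * (1 - 2 * shapeSeries) = 0 := by
    linear_combination h - hT
  rcases mul_eq_zero.1 this with h0 | h0
  · exact sub_eq_zero.1 h0
  · exfalso
    have h1 : (PowerSeries.X : PowerSeries ℝ) = 0 := by
      linear_combination shapeSeries * h0 - hT
    exact PowerSeries.X_ne_zero h1

lemma X_mul_momentSeries_two :
    PowerSeries.X * momentSeries 2 = shapeSeries ^ 3 := by
  have h := momentSeries_eq 2
  simp [Nat.antidiagonal_succ, momentSeries_zero, momentSeries_one] at h
  linear_combination shapeSeries * h - momentSeries 2 * shapeSeries_eq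

lemma X_sq_mul_momentSeries_three :
    PowerSeries.X ^ 2 * momentSeries 3 = 2 * shapeSeries ^ 5 := by
  have h := momentSeries_eq 3
  simp [Nat.antidiagonal_succ, Nat.choose_eq_zero_of_lt, momentSeries_zero, momentSeries_one] at h
  linear_combination PowerSeries.X * shapeSeries * h
    - PowerSeries.X * momentSeries 3 * shapeSeries_eq
    + 2 * shapeSeries ^ 2 * X_mul_momentSeries_two

lemma X_cube_mul_momentSeries_four :
    PowerSeries.X ^ 3 * momentSeries 4 = 5 * shapeSeries ^ 7 := by
  have h := momentSeries_eq 4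
  simp [Nat.antidiagonal_succ, Nat.choose_eq_zero_of_lt, momentSeries_zero, momentSeries_one] at h
  linear_combination PowerSeries.X ^ 2 * shapeSeries * h
    - PowerSeries.X ^ 2 * momentSeries 4 * shapeSeries_eq
    + 2 * shapeSeries ^ 2 * X_sq_mul_momentSeries_three
    + shapeSeries * (PowerSeries.X * momentSeries 2 + shapeSeries ^ 3) * X_mul_momentSeries_two

lemma sum_choose_two {n : ℕ} (hn : 1 ≤ n) :
    ∑ s ∈ shapes n, ((orCount s).choose 2 : ℝ) = (#(shapes (n + 1)) - 2 * #(shapes n)) / 4 := by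
  have h : PowerSeries.X * (4 * momentSeries 2) =
      shapeSeries - PowerSeries.X - 2 * (PowerSeries.X * shapeSeries) := by
    linear_combination 4 * X_mul_momentSeries_two
      + (-2 * shapeSeries - 1) * shapeSeries_eq
  have hc := congrArg (PowerSeries.coeff (n + 1)) h
  have e4 : (4 : PowerSeries ℝ) = PowerSeries.C (4 : ℝ) := (map_ofNat _ 4).symm
  have e2 : (2 : PowerSeries ℝ) = PowerSeries.C (2 : ℝ) := (map_ofNat _ 2).symm
  rw [e4, e2] at hc
  simp only [map_sub, PowerSeries.coeff_succ_X_mul, PowerSeries.coeff_C_mul, coeff_shapeSeries,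
    coeff_momentSeries, PowerSeries.coeff_X] at hc
  rw [if_neg (by omega)] at hc
  linarith

lemma coeff_shapeSeries_pow_nonneg (m n : ℕ) : 0 ≤ PowerSeries.coeff n (shapeSeries ^ m) := by
  induction m generalizing n with
  | zero => simp only [pow_zero, PowerSeries.coeff_one]; split_ifs <;> norm_num
  | succ m ih =>
    rw [pow_succ, PowerSeries.coeff_mul]
    refine sum_nonneg fun p _ => mul_nonneg (ih _) ?_
    rw [coeff_shapeSeries]
    positivity

lemma coeff_shapeSeries_pow_le (m n : ℕ) :
    PowerSeries.coeff n (shapeSeries ^ (m + 1)) ≤ #(shapes n) := by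
  induction m generalizing n with
  | zero => simp [coeff_shapeSeries]
  | succ m ih =>
    have h1 : PowerSeries.coeff n (shapeSeries ^ (m + 1 + 1)) ≤
        PowerSeries.coeff n (shapeSeries ^ 2) := by
      rw [pow_succ, pow_two, PowerSeries.coeff_mul, PowerSeries.coeff_mul]
      refine sum_le_sum fun p _ => ?_
      simp only [coeff_shapeSeries]
      exact mul_le_mul_of_nonneg_right (ih _) (by positivity)
    have h2 := congrArg (PowerSeries.coeff n) shapeSeries_eq
    have e2 : (2 : PowerSeries ℝ) = PowerSeries.C (2 : ℝ) := (map_ofNat _ 2).symm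
    rw [e2, map_add, PowerSeries.coeff_C_mul, PowerSeries.coeff_X, coeff_shapeSeries] at h2
    have h3 := coeff_shapeSeries_pow_nonneg 2 n
    split_ifs at h2 <;> linarith

lemma sum_choose_three_le (n : ℕ) :
    ∑ s ∈ shapes n, ((orCount s).choose 3 : ℝ) ≤ 2 * #(shapes (n + 2)) := by
  have hc := congrArg (PowerSeries.coeff (n + 2)) X_sq_mul_momentSeries_three
  have e : (2 : PowerSeries ℝ) = PowerSeries.C (2 : ℝ) := (map_ofNat _ 2).symm
  rw [PowerSeries.coeff_X_pow_mul, e, PowerSeries.coeff_C_mul, coeff_momentSeries] at hc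
  rw [hc]
  exact mul_le_mul_of_nonneg_left (coeff_shapeSeries_pow_le 4 _) (by norm_num)

lemma sum_choose_four_le (n : ℕ) :
    ∑ s ∈ shapes n, ((orCount s).choose 4 : ℝ) ≤ 5 * #(shapes (n + 3)) := by
  have hc := congrArg (PowerSeries.coeff (n + 3)) X_cube_mul_momentSeries_four
  have e : (5 : PowerSeries ℝ) = PowerSeries.C (5 : ℝ) := (map_ofNat _ 5).symm
  rw [PowerSeries.coeff_X_pow_mul, e, PowerSeries.coeff_C_mul, coeff_momentSeries] at hc
  rw [hc]
  exact mul_le_mul_of_nonneg_left (coeff_shapeSeries_pow_le 6 _) (by norm_num)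

lemma card_shapes_zero : (#(shapes 0) : ℝ) = 0 := by
  have : shapes 0 = ∅ := by
    ext s
    have := s.one_le_size
    simp only [mem_shapes, notMem_empty, iff_false]
    omega
  simp [this]

lemma card_shapes_succ (n : ℕ) : (#(shapes (n + 1)) : ℝ) = 2 ^ n * catalan n := by
  have hrec (m : ℕ) : (#(shapes m) : ℝ) = (if m = 1 then 1 else 0) +
      2 * ∑ p ∈ antidiagonal m, (#(shapes p.1) : ℝ) * #(shapes p.2) := by
    have h2 := congrArg (PowerSeries.coeff m) shapeSeries_eq
    have e2 : (2 : PowerSeries ℝ) = PowerSeries.C (2 : ℝ) := (map_ofNat _ 2).symm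
    rw [e2, map_add, PowerSeries.coeff_C_mul, PowerSeries.coeff_X, pow_two,
      PowerSeries.coeff_mul] at h2
    simpa only [coeff_shapeSeries] using h2
  induction n using Nat.strong_induction_on with
  | _ n ih =>
    rw [hrec]
    cases n with
    | zero =>
      simp [Nat.antidiagonal_succ, card_shapes_zero]
    | succ n =>
      rw [if_neg (by omega), Nat.antidiagonal_succ_succ', catalan_succ']
      simp only [sum_cons, sum_map, card_shapes_zero, zero_mul, mul_zero, zero_add,
        Function.Embedding.prodMap, Function.Embedding.coeFn_mk, Prod.map, Nat.succ_eq_add_one]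
      push_cast
      rw [mul_sum, mul_sum]
      refine sum_congr rfl fun p hp => ?_
      have hp' := HasAntidiagonal.mem_antidiagonal.1 hp
      rw [ih p.1 (by omega), ih p.2 (by omega), ← hp']
      ring

lemma card_shapes_pos (n : ℕ) : (0 : ℝ) < #(shapes (n + 1)) := by
  rw [card_shapes_succ]
  have : 0 < catalan n := by
    have h := succ_mul_catalan_eq_centralBinom n
    have h' := Nat.centralBinom_pos n
    by_contra h0
    simp only [not_lt, nonpos_iff_eq_zero] at h0
    simp [h0] at h
    omega
  positivity

lemma card_shapes_ratio (n : ℕ) :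
    (#(shapes (n + 2)) : ℝ) / #(shapes (n + 1)) = 8 - 12 / ((n : ℝ) + 2) := by
  have h0 := card_shapes_pos n
  have h1 := congrArg (Nat.cast : ℕ → ℝ) (Nat.succ_mul_centralBinom_succ n)
  rw [← succ_mul_catalan_eq_centralBinom, ← succ_mul_catalan_eq_centralBinom] at h1
  push_cast at h1
  have h2 : ((n : ℝ) + 2) * catalan (n + 1) = 2 * (2 * n + 1) * catalan n := by
    have : ((n : ℝ) + 1) ≠ 0 := by positivity
    apply mul_left_cancel₀ this
    linear_combination h1
  rw [div_eq_iff h0.ne', card_shapes_succ, card_shapes_succ]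
  field_simp
  rw [pow_succ]
  linear_combination (2 * 2 ^ n) * h2

lemma tendsto_card_shapes_ratio :
    Tendsto (fun n => (#(shapes (n + 1)) : ℝ) / #(shapes n)) atTop (nhds 8) := by
  rw [← tendsto_add_atTop_iff_nat 1]
  simp only [card_shapes_ratio, add_assoc, Nat.reduceAdd]
  have h : Tendsto (fun n : ℕ => (n : ℝ) + 2) atTop atTop :=
    tendsto_natCast_atTop_atTop.atTop_add tendsto_const_nhds
  simpa using tendsto_const_nhds.sub (h.const_div_atTop 12)

lemma mul_stirling_le (m p : ℕ) : p * stirling m p ≤ stirling (m + 1) p := by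
  cases p with
  | zero => simp
  | succ p => simp only [stirling]; omega

lemma stirling_le (m p : ℕ) : stirling m p ≤ (p + 1) ^ m := by
  induction m generalizing p with
  | zero => cases p <;> simp [stirling]
  | succ m ih =>
    cases p with
    | zero => simp [stirling]
    | succ p =>
      have h1 := ih (p + 1)
      have h2 := ih p
      have h3 : (p + 1) ^ m ≤ (p + 1 + 1) ^ m := Nat.pow_le_pow_left (by omega) m
      simp only [stirling]
      rw [pow_succ]
      nlinarith

lemma stirling_self (p : ℕ) : 1 ≤ stirling p p := by
  induction p with
  | zero => simp [stirling]
  | succ p ih => simp only [stirling]; omega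

lemma le_stirling (q d : ℕ) : q ^ d ≤ stirling (q + d) q := by
  induction d with
  | zero => simpa using stirling_self q
  | succ d ih =>
    have := mul_stirling_le (q + d) q
    rw [pow_succ, mul_comm]
    exact (Nat.mul_le_mul_left q ih).trans this

lemma B_pos {m K : ℕ} (hm : 1 ≤ m) (hK : 1 ≤ K) : 0 < B m K := by
  refine sum_pos' (fun p _ => by positivity) ⟨1, by simp [hK], ?_⟩
  obtain ⟨d, rfl⟩ := Nat.exists_eq_add_of_le hm
  have := le_stirling 1 d
  rw [one_pow] at this
  have : (0 : ℝ) < stirling (1 + d) 1 := by exact_mod_cast this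
  positivity

lemma mul_B_le {m K P : ℕ} (hK : P + 1 ≤ K)
    (h : (P : ℝ) * (P * P ^ m) ≤ stirling m (P + 1) / 2 ^ (P + 1)) :
    P * B m K ≤ B (m + 1) K := by
  have hterm (p : ℕ) : (P : ℝ) * ((stirling m p : ℝ) / 2 ^ p) +
      ((if P + 1 = p then (stirling m (P + 1) : ℝ) / 2 ^ (P + 1) else 0) -
        (if p < P then (P : ℝ) * P ^ m else 0)) ≤ (stirling (m + 1) p : ℝ) / 2 ^ p := by
    have h1 : (p : ℝ) * ((stirling m p : ℝ) / 2 ^ p) ≤ (stirling (m + 1) p : ℝ) / 2 ^ p := by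
      rw [mul_div_assoc']
      gcongr
      exact_mod_cast mul_stirling_le m p
    have h0 : 0 ≤ (stirling m p : ℝ) / 2 ^ p := by positivity
    rcases lt_trichotomy p P with hp | rfl | hp
    · rw [if_neg (by omega), if_pos hp]
      have h2 : (stirling m p : ℝ) / 2 ^ p ≤ P ^ m := by
        refine (div_le_self (by positivity) (one_le_pow₀ (by norm_num))).trans ?_
        exact_mod_cast (stirling_le m p).trans (Nat.pow_le_pow_left hp m)
      have h3 := mul_le_mul_of_nonneg_left h2 (Nat.cast_nonneg (α := ℝ) P)
      have h4 : 0 ≤ (p : ℝ) * ((stirling m p : ℝ) / 2 ^ p) := by positivity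
      linarith
    · rw [if_neg (by omega), if_neg (by omega)]
      linarith
    · rw [if_neg (by omega : ¬ p < P)]
      have hp' : (P : ℝ) + 1 ≤ p := by exact_mod_cast hp
      split_ifs with hq
      · subst hq
        push_cast at h1
        linarith
      · have := mul_le_mul_of_nonneg_right hp' h0
        linarith
  have hsum := sum_le_sum fun p (_ : p ∈ Icc 1 K) => hterm p
  rw [sum_add_distrib, sum_sub_distrib, ← mul_sum, sum_ite_eq, if_pos (by simp [hK])] at hsum
  have hlow : ∑ p ∈ Icc 1 K, (if p < P then (P : ℝ) * P ^ m else 0) ≤ P * (P * P ^ m) := by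
    rw [← sum_filter, sum_const, nsmul_eq_mul]
    gcongr
    calc #((Icc 1 K).filter fun p => p < P) ≤ #(range P) :=
          card_le_card fun p hp => mem_range.2 (mem_filter.1 hp).2
      _ = P := card_range P
  simp only [B]
  linarith

lemma eventually_mul_B_le (P : ℕ) :
    ∀ᶠ m in atTop, ∀ K, P + 1 ≤ K → P * B m K ≤ B (m + 1) K := by
  let c : ℝ := P * P * P ^ (P + 1) * 2 ^ (P + 1)
  have hr : Tendsto (fun d : ℕ => c * ((P : ℝ) / (P + 1)) ^ d) atTop (nhds (c * 0)) := by
    refine (tendsto_pow_atTop_nhds_zero_of_lt_one (by positivity) ?_).const_mul c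
    rw [div_lt_one (by positivity)]
    linarith
  rw [mul_zero] at hr
  have hd := (tendsto_sub_atTop_nat (P + 1)).eventually (hr.eventually (ge_mem_nhds zero_lt_one))
  filter_upwards [hd, eventually_ge_atTop (P + 1)] with m hm hmP K hK
  obtain ⟨d, rfl⟩ := Nat.exists_eq_add_of_le hmP
  refine mul_B_le hK ?_
  have hs : ((P : ℝ) + 1) ^ d ≤ stirling (P + 1 + d) (P + 1) := by
    exact_mod_cast le_stirling (P + 1) d
  rw [Nat.add_sub_cancel_left, div_pow, mul_div_assoc', div_le_one (by positivity)] at hm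
  rw [le_div_iff₀ (by positivity)]
  calc (P : ℝ) * (P * P ^ (P + 1 + d)) * 2 ^ (P + 1) = c * P ^ d := by simp only [c]; ring
    _ ≤ _ := hm.trans hs

lemma tendsto_B_div_B {k : ℕ → ℕ} (hk : Tendsto k atTop atTop) :
    Tendsto (fun n => B n (k (n + 2)) / B (n + 1) (k (n + 2))) atTop (nhds 0) := by
  have hk2 : Tendsto (fun n => k (n + 2)) atTop atTop := hk.comp (tendsto_add_atTop_nat 2)
  rw [Metric.tendsto_nhds]
  intro ε hε
  obtain ⟨P, hP⟩ := exists_nat_gt (1 / ε)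
  have hP0 : (0 : ℝ) < P := (by positivity : (0 : ℝ) < 1 / ε).trans hP
  filter_upwards [eventually_mul_B_le P, hk2.eventually_ge_atTop (P + 1),
    eventually_ge_atTop 1] with n hn hkn hn1
  have h1 := B_pos hn1 (by omega : 1 ≤ k (n + 2))
  have h2 := B_pos (by omega : 1 ≤ n + 1) (by omega : 1 ≤ k (n + 2))
  rw [Real.dist_0_eq_abs, abs_of_pos (by positivity), div_lt_iff₀ h2]
  rw [div_lt_iff₀ hε] at hP
  calc B n (k (n + 2)) < (P * ε) * B n (k (n + 2)) := by nlinarith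
    _ = ε * (P * B n (k (n + 2))) := by ring
    _ ≤ _ := mul_le_mul_of_nonneg_left (hn _ hkn) hε.le

lemma simple_ratio_eq (n K : ℕ) (hK : 1 ≤ K) (S : ℝ) :
    S / (Tcount (n + 2) K : ℝ) / (B (n + 1) K / B (n + 2) K) =
      S / (#(shapes (n + 2)) * (2 ^ (n + 2) * B (n + 1) K)) := by
  have h := B_pos (by omega : 1 ≤ n + 2) hK
  have h' := B_pos (by omega : 1 ≤ n + 1) hK
  have h'' := card_shapes_pos (n + 1)
  rw [Tcount_eq, Nat.cast_mul, card_codesLE_eq (by omega)]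
  field_simp

lemma simple_ratio_le (n K : ℕ) (hK : 1 ≤ K) :
    ((classCount fun t => t.size = n + 2 ∧ t.varCount ≤ K ∧ IsSimpleTautology t : ℕ) : ℝ) /
      (Tcount (n + 2) K : ℝ) / (B (n + 1) K / B (n + 2) K) ≤
      ((#(shapes (n + 3)) : ℝ) / #(shapes (n + 2)) - 2) / 8 := by
  have h' := B_pos (by omega : 1 ≤ n + 1) hK
  have h'' := card_shapes_pos (n + 1)
  have hle := (Nat.cast_le (α := ℝ)).2 (classCount_simple_le (n + 1) K)
  rw [Nat.cast_mul, card_codesLE_eq (by omega), Nat.cast_sum, sum_choose_two (by omega)] at hle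
  rw [simple_ratio_eq n K hK, div_le_iff₀ (by positivity)]
  refine hle.trans_eq ?_
  field_simp
  ring

lemma le_simple_ratio (n K : ℕ) (hn : 1 ≤ n) (hK : 1 ≤ K) :
    ((#(shapes (n + 3)) : ℝ) / #(shapes (n + 2)) - 2) / 8 -
      3 / 2 * (2 * ((#(shapes (n + 4)) : ℝ) / #(shapes (n + 2))) +
        5 * ((#(shapes (n + 5)) : ℝ) / #(shapes (n + 2)))) * (B n K / B (n + 1) K) ≤
    ((classCount fun t => t.size = n + 2 ∧ t.varCount ≤ K ∧ IsSimpleTautology t : ℕ) : ℝ) /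
      (Tcount (n + 2) K : ℝ) / (B (n + 1) K / B (n + 2) K) := by
  have h := B_pos hn hK
  have h' := B_pos (by omega : 1 ≤ n + 1) hK
  have h'' := card_shapes_pos (n + 1)
  have hle := (Nat.cast_le (α := ℝ)).2 (le_classCount_simple n K)
  push_cast at hle
  rw [card_codesLE_eq (by omega), card_codesLE_eq hn, sum_choose_two (by omega)] at hle
  have h3 := sum_choose_three_le (n + 2)
  have h4 := sum_choose_four_le (n + 2)
  have hD : (0 : ℝ) ≤ 2 ^ n * B n K := by positivity
  have h34 := mul_le_mul_of_nonneg_right (add_le_add h3 h4) hD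
  rw [simple_ratio_eq n K hK, le_div_iff₀ (by positivity)]
  calc _ = (#(shapes (n + 3)) - 2 * #(shapes (n + 2))) / 4 * (2 ^ (n + 1) * B (n + 1) K) -
        6 * ((2 * #(shapes (n + 2 + 2)) + 5 * #(shapes (n + 2 + 3))) * (2 ^ n * B n K)) := by
        field_simp
        ring
    _ ≤ _ := by linarith

end

/-- the ratio of simple tautologies satisfies
`ST_n/T_n ∼ (3/4)·rat_n`. -/
theorem stmt_11 (k : ℕ → ℕ) (hk_mono : Monotone k)
    (hk_pos : ∀ n, 1 ≤ n → 1 ≤ k n) (hk_le : ∀ n, 1 ≤ n → k n ≤ n)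
    (hk_tend : Tendsto k atTop atTop) :
    Tendsto
      (fun n =>
        ((classCount fun t =>
            t.size = n ∧ t.varCount ≤ k n ∧ IsSimpleTautology t : ℕ) : ℝ)
          / (Tcount n (k n) : ℝ) / rat k n)
      atTop (nhds (3 / 4)) := by
  rw [← tendsto_add_atTop_iff_nat 2]
  have ht := tendsto_card_shapes_ratio
  have ht2 := ht.comp (tendsto_add_atTop_nat 2)
  have ht3 := ht.comp (tendsto_add_atTop_nat 3)
  have ht4 := ht.comp (tendsto_add_atTop_nat 4)
  simp only [Function.comp_def, add_assoc, Nat.reduceAdd] at ht2 ht3 ht4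
  have hpos (n : ℕ) := card_shapes_pos n
  have hr2 : Tendsto (fun n => ((shapes (n + 4)).card : ℝ) / (shapes (n + 2)).card) atTop
      (nhds (8 * 8)) := by
    refine (ht3.mul ht2).congr fun n => ?_
    exact div_mul_div_cancel₀ (hpos (n + 2)).ne'
  have hr3 : Tendsto (fun n => ((shapes (n + 5)).card : ℝ) / (shapes (n + 2)).card) atTop
      (nhds (8 * (8 * 8))) := by
    refine (ht4.mul hr2).congr fun n => ?_
    exact div_mul_div_cancel₀ (hpos (n + 3)).ne'
  have hup : Tendsto (fun n => (((shapes (n + 3)).card : ℝ) / (shapes (n + 2)).card - 2) / 8) atTop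
      (nhds (3 / 4)) := by
    convert (ht2.sub_const 2).div_const 8 using 2
    norm_num
  have herr := (((hr2.const_mul 2).add (hr3.const_mul 5)).const_mul (3 / 2)).mul
    (tendsto_B_div_B hk_tend)
  have hlow := hup.sub herr
  rw [mul_zero, sub_zero] at hlow
  refine tendsto_of_tendsto_of_tendsto_of_le_of_le' hlow hup ?_ ?_
  · filter_upwards [eventually_ge_atTop 1] with n hn
    exact le_simple_ratio n _ hn (hk_pos _ (by omega))
  · filter_upwards with n
    exact simple_ratio_le n _ (hk_pos _ (by omega))

end CatalanSat
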